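/- arXiv:1103.2838 — 2 statements merged into one kernel-verified Lean document; each statement's English description precedes it below -/
import Mathlib

section
/- Let λ be a cardinal with ω < cf(λ) < λ, let ⟨e_δ : δ ∈ E^{λ⁺}_{cf(λ)}⟩ be a club guessing sequence (each e_δ a club in δ of order type cf(λ), and for every club E ⊆ λ⁺ stationarily many δ ∈ E^{λ⁺}_{cf(λ)} with sup{cf(α) : α ∈ e_δ ∩ E} = λ), and let ⟨C_α : α < λ⁺⟩ satisfy: max(C_{α+1}) = α, C_α is a club in α of size < λ, and δ ∈ C_α ∩ E^{λ⁺}_{cf(λ)} implies e_δ ⊆ C_α. Then for all cofinal subsets A, B of λ⁺ and every cardinal θ < λ, the set S^{A,B}_{>θ} := {ε ∈ E^{λ⁺}_{>θ} : there exist k₁, k₂ < ω and η < ε with |B_{k₁,η}(ε)| = |A_{k₂,η}(ε)| = λ⁺} is stationary in λ⁺. -/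
open Ordinal Cardinal Set

/-- `C` is closed in the ordinal `o`: every limit point of `C` below `o` belongs to `C`. -/
def IsClosedIn (C : Set Ordinal) (o : Ordinal) : Prop :=
  ∀ p, p < o → p ≠ 0 → (∀ q < p, ∃ r ∈ C, q < r ∧ r < p) → p ∈ C

/-- `C` is a club (closed unbounded) subset of the ordinal `o`. -/
def IsClubIn (C : Set Ordinal) (o : Ordinal) : Prop :=
  C ⊆ Set.Iio o ∧ IsClosedIn C o ∧ ∀ p < o, ∃ q ∈ C, p ≤ q

/-- `S` is stationary in the ordinal `o`: it meets every club subset of `o`. -/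
def IsStationaryIn (S : Set Ordinal) (o : Ordinal) : Prop :=
  S ⊆ Set.Iio o ∧ ∀ C, IsClubIn C o → (S ∩ C).Nonempty

/-- `A` is a cofinal (unbounded) subset of the ordinal `o`. -/
def IsCofinalIn (A : Set Ordinal) (o : Ordinal) : Prop :=
  A ⊆ Set.Iio o ∧ ∀ p < o, ∃ q ∈ A, p ≤ q

/-- A cardinal is singular if it is infinite and its cofinality is smaller than itself. -/
def IsSingular (c : Cardinal) : Prop :=
  Cardinal.aleph0 ≤ c ∧ c.ord.cof < c

/-- The minimal walk along the `C`-sequence: `walk C α β n` is the `n`-th step `β_n`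
of the walk from `β` down to `α` (it stabilizes once it reaches `α`). -/
noncomputable def walk (C : Ordinal.{0} → Set Ordinal.{0}) (α β : Ordinal.{0}) :
    ℕ → Ordinal.{0}
  | 0 => β
  | n + 1 =>
      let b := walk C α β n
      if α < b then sInf (C b ∩ Set.Ici α) else b

/-- `ρ(α,β)`: the length of the `C`-walk from `β` down to `α`. -/
noncomputable def rho (C : Ordinal.{0} → Set Ordinal.{0}) (α β : Ordinal.{0}) : ℕ :=
  sInf {k | walk C α β k = α}

/-- `max {sup (C_τ ∩ ε) : τ ∈ tr(ε,β)}`, the maximum over the trace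
`tr(ε,β) = {β_0, …, β_{k-1}}` of the walk from `β` down to `ε`. -/
noncomputable def trMaxSup (C : Ordinal.{0} → Set Ordinal.{0}) (ε β : Ordinal.{0}) :
    Ordinal.{0} :=
  ⨆ i : Fin (rho C ε β), sSup (C (walk C ε β i) ∩ Set.Iio ε)

/-- `A_{k,η}(ε) = {α ∈ A : α > ε, ρ(ε,α) = k, max {sup (C_τ ∩ ε) : τ ∈ tr(ε,α)} = η}`. -/
def walkSlice (C : Ordinal.{0} → Set Ordinal.{0}) (A : Set Ordinal.{0}) (k : ℕ)
    (η ε : Ordinal.{0}) : Set Ordinal.{0} :=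
  {α ∈ A | ε < α ∧ rho C ε α = k ∧ trMaxSup C ε α = η}

section Walk

variable {C : Ordinal.{0} → Set Ordinal.{0}} {ε β : Ordinal.{0}}

theorem IsClubIn.sInf_inter_Ici {D : Set Ordinal.{0}} (hD : IsClubIn D β) (h : ε < β) :
    sInf (D ∩ Ici ε) ∈ D ∧ ε ≤ sInf (D ∩ Ici ε) ∧ sInf (D ∩ Ici ε) < β := by
  obtain ⟨q, hq, hεq⟩ := hD.2.2 ε h
  have hm : sInf (D ∩ Ici ε) ∈ D ∩ Ici ε := csInf_mem ⟨q, hq, hεq⟩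
  exact ⟨hm.1, hm.2, hD.1 hm.1⟩

theorem walk_succ_of_lt (h : ε < β) (n : ℕ) :
    walk C ε β (n + 1) = walk C ε (sInf (C β ∩ Ici ε)) n := by
  induction n with
  | zero => simp [walk, h]
  | succ n ih => rw [walk, ih, walk]

theorem exists_walk_eq {o : Ordinal.{0}} (hC : ∀ α < o, IsClubIn (C α) α) (h : ε ≤ β)
    (hβ : β < o) : ∃ n, walk C ε β n = ε := by
  induction β using WellFoundedLT.induction with
  | ind β ih =>
    rcases h.eq_or_lt with rfl | h
    · exact ⟨0, rfl⟩
    · obtain ⟨-, h1, h2⟩ := (hC β hβ).sInf_inter_Ici h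
      obtain ⟨n, hn⟩ := ih _ h2 h1 (h2.trans hβ)
      exact ⟨n + 1, (walk_succ_of_lt h n).trans hn⟩

theorem rho_self : rho C ε ε = 0 :=
  Nat.sInf_eq_zero.2 (Or.inl rfl)

theorem rho_of_lt {o : Ordinal.{0}} (hC : ∀ α < o, IsClubIn (C α) α) (h : ε < β)
    (hβ : β < o) : rho C ε β = rho C ε (sInf (C β ∩ Ici ε)) + 1 := by
  obtain ⟨-, h1, h2⟩ := (hC β hβ).sInf_inter_Ici h
  have hne : {k | walk C ε (sInf (C β ∩ Ici ε)) k = ε}.Nonempty :=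
    exists_walk_eq hC h1 (h2.trans hβ)
  have hne' : {k | walk C ε β k = ε}.Nonempty := exists_walk_eq hC h.le hβ
  apply le_antisymm
  · exact Nat.sInf_le ((walk_succ_of_lt h _).trans (Nat.sInf_mem hne))
  · have hk : walk C ε β (rho C ε β) = ε := Nat.sInf_mem hne'
    cases hr : rho C ε β with
    | zero =>
      rw [hr] at hk
      exact absurd hk h.ne'
    | succ k =>
      rw [hr, walk_succ_of_lt h] at hk
      exact Nat.succ_le_succ (Nat.sInf_le hk)

theorem trMaxSup_self : trMaxSup C ε ε = 0 := by
  rw [trMaxSup, rho_self, ciSup_of_empty, bot_eq_zero]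

theorem iSup_fin_succ_eq_max (f : ℕ → Ordinal.{0}) (n : ℕ) :
    ⨆ i : Fin (n + 1), f i = max (f 0) (⨆ i : Fin n, f (i + 1)) := by
  apply le_antisymm
  · refine Ordinal.iSup_le fun i ↦ ?_
    cases i using Fin.cases with
    | zero => exact le_max_left _ _
    | succ i => exact le_max_of_le_right (Ordinal.le_iSup (fun i : Fin n ↦ f (i + 1)) i)
  · refine max_le (Ordinal.le_iSup (fun i : Fin (n + 1) ↦ f i) 0) (Ordinal.iSup_le fun i ↦ ?_)
    exact Ordinal.le_iSup (fun i : Fin (n + 1) ↦ f i) i.succ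

theorem trMaxSup_of_lt {o : Ordinal.{0}} (hC : ∀ α < o, IsClubIn (C α) α) (h : ε < β)
    (hβ : β < o) : trMaxSup C ε β =
      max (sSup (C β ∩ Iio ε)) (trMaxSup C ε (sInf (C β ∩ Ici ε))) := by
  rw [trMaxSup, rho_of_lt hC h hβ,
    iSup_fin_succ_eq_max (fun i ↦ sSup (C (walk C ε β i) ∩ Iio ε))]
  simp only [walk_succ_of_lt h]
  rfl

theorem bddAbove_inter_Iio (D : Set Ordinal.{0}) (o : Ordinal.{0}) : BddAbove (D ∩ Iio o) :=
  ⟨o, fun _ hx ↦ hx.2.le⟩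

theorem inter_Ici_congr {D : Set Ordinal.{0}} {ε' : Ordinal.{0}} (h : ε' ≤ ε)
    (hD : ∀ x ∈ D, x < ε → x < ε') : D ∩ Ici ε' = D ∩ Ici ε := by
  ext x
  refine and_congr_right fun hx ↦ ⟨fun hx' ↦ ?_, fun hx' ↦ h.trans hx'⟩
  by_contra hlt
  exact (hD x hx (not_le.1 hlt)).not_ge hx'

/-- If no set on the walk from `β` to `ε` meets `[ε', ε)`, then the walk from `β` to `ε'`
passes through `ε`. -/
theorem trMaxSup_eq_max {o ε' : Ordinal.{0}} (hC : ∀ α < o, IsClubIn (C α) α) (hε : ε' ≤ ε)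
    (h : ε ≤ β) (hβ : β < o) (hlt : trMaxSup C ε β < ε') :
    trMaxSup C ε' β = max (trMaxSup C ε β) (trMaxSup C ε' ε) := by
  induction β using WellFoundedLT.induction with
  | ind β ih =>
    rcases h.eq_or_lt with rfl | h
    · simp [trMaxSup_self]
    · obtain ⟨-, h1, h2⟩ := (hC β hβ).sInf_inter_Ici h
      rw [trMaxSup_of_lt hC h hβ, max_lt_iff] at hlt
      have hgap : ∀ x ∈ C β, x < ε → x < ε' := fun x hx hxε ↦
        (le_csSup (bddAbove_inter_Iio _ _) ⟨hx, hxε⟩).trans_lt hlt.1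
      have hIio : C β ∩ Iio ε' = C β ∩ Iio ε := by
        ext x
        exact and_congr_right fun hx ↦ ⟨fun hx' ↦ hx'.trans_le hε, hgap x hx⟩
      rw [trMaxSup_of_lt hC h hβ, trMaxSup_of_lt hC (hε.trans_lt h) hβ,
        inter_Ici_congr hε hgap, hIio, ih _ h2 h1 (h2.trans hβ) hlt.2, max_assoc]

/-- Once `δ` is fixed, the walk from `β` to any sufficiently large point `ε` of `e δ` of
sufficiently large cofinality never accumulates to `ε`. -/
theorem exists_bound_trMaxSup_lt {lam ν : Cardinal.{0}} {o δ : Ordinal.{0}}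
    {e : Ordinal.{0} → Set Ordinal.{0}}
    (hC : ∀ α < o, IsClubIn (C α) α) (hcard : ∀ α < o, #(C α) < Cardinal.lift.{1} lam)
    (he : ∀ α < o, ∀ δ ∈ C α, cof δ = ν → e δ ⊆ C α) (hδ : cof δ = ν) (hδ0 : 0 < δ)
    (heδ : e δ ⊆ Iio δ) (h : δ < β) (hβ : β < o) :
    ∃ γ < δ, ∃ μ < lam, ∀ ε ∈ e δ, γ < ε → μ < cof ε → trMaxSup C ε β < ε := by
  induction β using WellFoundedLT.induction with
  | ind β ih =>
    by_cases hmem : δ ∈ C β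
    · obtain ⟨μ, hμlam, hμ⟩ := Cardinal.lt_lift_iff.1 (hcard β hβ)
      refine ⟨0, hδ0, μ, hμlam, fun ε hε hε0 hcof ↦ ?_⟩
      have hεC : ε ∈ C β := he β hβ δ hmem hδ hε
      have hinf : sInf (C β ∩ Ici ε) = ε :=
        le_antisymm (csInf_le' ⟨hεC, self_mem_Ici⟩) (le_csInf ⟨ε, hεC, self_mem_Ici⟩ fun x hx ↦ hx.2)
      rw [trMaxSup_of_lt hC ((heδ hε).trans h) hβ, hinf, trMaxSup_self]
      refine max_lt (sSup_lt_of_lt_cof ?_ fun x hx ↦ hx.2) hε0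
      rw [← lift_cof]
      exact (mk_le_mk_of_subset inter_subset_left).trans_lt
        (hμ ▸ Cardinal.lift_lt.2 hcof)
    · have hgap : ∃ q < δ, ∀ r ∈ C β, q < r → δ ≤ r := by
        by_contra! hcon
        exact hmem ((hC β hβ).2.1 δ h hδ0.ne' hcon)
      obtain ⟨q, hqδ, hq⟩ := hgap
      obtain ⟨hm, h1, h2⟩ := (hC β hβ).sInf_inter_Ici h
      have h1' : δ < sInf (C β ∩ Ici δ) := h1.lt_of_ne fun heq ↦ hmem (heq ▸ hm)
      obtain ⟨γ, hγ, μ, hμ, H⟩ := ih _ h2 h1' (h2.trans hβ)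
      refine ⟨max q γ, max_lt hqδ hγ, μ, hμ, fun ε hε hlt hcof ↦ ?_⟩
      rw [max_lt_iff] at hlt
      have hεδ : ε < δ := heδ hε
      have hbelow : ∀ x ∈ C β, x < δ → x ≤ q := fun x hx hxδ ↦
        not_lt.1 fun hqx ↦ (hq x hx hqx).not_gt hxδ
      rw [trMaxSup_of_lt hC (hεδ.trans h) hβ, inter_Ici_congr hεδ.le
        fun x hx hxδ ↦ (hbelow x hx hxδ).trans_lt hlt.1]
      refine max_lt (lt_of_le_of_lt ?_ hlt.1) (H ε hε hlt.2 hcof)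
      exact csSup_le' fun x hx ↦ hbelow x hx.1 (hx.2.trans hεδ)

end Walk

theorem cof_lt_of_lt_ord_succ {lam : Cardinal.{0}} (h : lam.ord.cof < lam) {ε : Ordinal.{0}}
    (hε : ε < (Order.succ lam).ord) : cof ε < lam := by
  have hle : cof ε ≤ lam := (cof_le_card ε).trans (Order.lt_succ_iff.1 (lt_ord.1 hε))
  refine hle.lt_of_ne fun heq ↦ ?_
  rw [← heq, cof_ord_cof] at h
  exact h.false

/-- A club of order type `cof lam.ord` meeting `E` in points of cofinalities unbounded in `lam`
contains such points above any given bound. -/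
theorem exists_mem_inter_lt_cof {lam : Cardinal.{0}} (h1 : ℵ₀ < lam.ord.cof)
    (h2 : lam.ord.cof < lam) {δ γ : Ordinal.{0}} (hδ : δ < (Order.succ lam).ord)
    (hcof : cof δ = lam.ord.cof) {D E : Set Ordinal.{0}} (hD : IsClubIn D δ)
    (f : D ≃o Iio lam.ord.cof.ord) (hs : sSup (cof '' (D ∩ E)) = lam) (hγ : γ < δ)
    {μ : Cardinal.{0}} (hμ : μ < lam) : ∃ ε ∈ D, ε ∈ E ∧ γ < ε ∧ μ < cof ε := by
  by_contra! hcon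
  have hlim : Order.IsSuccLimit δ := one_lt_cof_iff.1 (hcof ▸ one_lt_aleph0.trans h1)
  obtain ⟨q, hq, hγq⟩ := hD.2.2 _ (hlim.succ_lt hγ)
  rw [Order.succ_le_iff] at hγq
  have hcard : #↥(D ∩ Iic γ) < (Cardinal.lift.{1} lam).ord.cof := by
    have hinj : #↥(D ∩ Iic γ) ≤ #(Iio (f ⟨q, hq⟩).1) := by
      refine mk_le_of_injective (f := fun x ↦ ⟨(f ⟨x.1, x.2.1⟩).1, ?_⟩) fun x y hxy ↦ ?_
      · have : (⟨x.1, x.2.1⟩ : D) < ⟨q, hq⟩ := (show x.1 ≤ γ from x.2.2).trans_lt hγq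
        exact f.lt_iff_lt.2 this
      · have := f.injective (Subtype.ext (Subtype.mk.inj hxy))
        exact Subtype.ext (Subtype.mk.inj this)
    refine hinj.trans_lt ?_
    rw [Cardinal.mk_Iio_ordinal, ← lift_ord, ← lift_cof, Cardinal.lift_lt]
    exact lt_ord.1 (f ⟨q, hq⟩).2
  have hlt : sSup (cof '' (D ∩ Iic γ)) < lam := by
    refine Cardinal.sSup_lt_of_lt_cof_ord (mk_image_le.trans_lt hcard) ?_
    rintro _ ⟨x, hx, rfl⟩
    exact cof_lt_of_lt_ord_succ h2 ((hD.1 hx.1).trans hδ)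
  have hbdd : BddAbove (cof '' (D ∩ Iic γ)) := by
    refine ⟨lam, ?_⟩
    rintro _ ⟨x, hx, rfl⟩
    exact (cof_lt_of_lt_ord_succ h2 ((hD.1 hx.1).trans hδ)).le
  have hle : sSup (cof '' (D ∩ E)) ≤ max μ (sSup (cof '' (D ∩ Iic γ))) := by
    refine csSup_le' ?_
    rintro _ ⟨x, hx, rfl⟩
    rcases le_or_gt x γ with hxγ | hxγ
    · exact le_max_of_le_right (le_csSup hbdd ⟨x, ⟨hx.1, hxγ⟩, rfl⟩)
    · exact le_max_of_le_left (hcon x hx.1 hx.2 hxγ)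
  exact (hle.trans_lt (max_lt hμ hlt)).ne hs

theorem IsStationaryIn.exists_gt {S : Set Ordinal.{0}} {o p : Ordinal.{0}}
    (hS : IsStationaryIn S o) (ho : Order.IsSuccLimit o) (hp : p < o) :
    ∃ s ∈ S, p < s := by
  have hclub : IsClubIn (Ioo p o) o := by
    refine ⟨fun x hx ↦ hx.2, fun x hx hx0 H ↦ ?_, fun x hx ↦ ⟨max x (Order.succ p),
      ⟨lt_max_of_lt_right (Order.lt_succ p), max_lt hx (ho.succ_lt hp)⟩, le_max_left _ _⟩⟩
    obtain ⟨r, hr, -, hrx⟩ := H 0 (pos_iff_ne_zero.2 hx0)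
    exact ⟨hr.1.trans hrx, hx⟩
  obtain ⟨s, hs, hs'⟩ := hS.2 _ hclub
  exact ⟨s, hs, hs'.1⟩

/-- The limit points of an unbounded set inside a club form a club. -/
theorem IsClubIn.inter_limits {E S : Set Ordinal.{0}} {o : Ordinal.{0}} (hE : IsClubIn E o)
    (ho : ℵ₀ < cof o) (hS : S ⊆ Iio o) (hSu : ∀ p < o, ∃ s ∈ S, p < s) :
    IsClubIn {x ∈ E | ∀ p < x, ∃ s ∈ S, p < s ∧ s < x} o := by
  have hlim : Order.IsSuccLimit o := one_lt_cof_iff.1 (one_lt_aleph0.trans ho)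
  refine ⟨fun x hx ↦ hE.1 hx.1, fun x hx hx0 H ↦ ⟨hE.2.1 x hx hx0 fun q hq ↦ ?_, fun p hp ↦ ?_⟩,
    fun p hp ↦ ?_⟩
  · obtain ⟨r, hr, h⟩ := H q hq
    exact ⟨r, hr.1, h⟩
  · obtain ⟨r, hr, hpr, hrx⟩ := H p hp
    obtain ⟨s, hs, hps, hsr⟩ := hr.2 p hpr
    exact ⟨s, hs, hps, hsr.trans hrx⟩
  · have step : ∀ x : Ordinal.{0}, ∃ t, x < o → t ∈ E ∧ ∃ s ∈ S, x < s ∧ s < t := by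
      intro x
      by_cases hx : x < o
      · obtain ⟨s, hs, hxs⟩ := hSu x hx
        obtain ⟨t, ht, hst⟩ := hE.2.2 _ (hlim.succ_lt (hS hs))
        exact ⟨t, fun _ ↦ ⟨ht, s, hs, hxs, Order.succ_le_iff.1 hst⟩⟩
      · exact ⟨0, fun h ↦ absurd h hx⟩
    choose f hf using step
    have hfo : ∀ i < o, f i < o := fun i hi ↦ hE.1 (hf i hi).1
    have hiter : ∀ n, f^[n] p < o := fun n ↦ by
      induction n with
      | zero => exact hp
      | succ n ih => exact Function.iterate_succ_apply' f n p ▸ hfo _ ih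
    have hnext : ∀ q < nfp f p, ∃ t ∈ E, t < nfp f p ∧ ∃ s ∈ S, q < s ∧ s < t := by
      intro q hq
      obtain ⟨n, hn⟩ := lt_nfp_iff.1 hq
      obtain ⟨ht, s, hs, hns, hst⟩ := hf _ (hiter n)
      refine ⟨_, ht, ?_, s, hs, hn.trans hns, hst⟩
      obtain ⟨-, s', -, h1, h2⟩ := hf _ (hfo _ (hiter n))
      refine (h1.trans h2).trans_le ?_
      rw [← Function.iterate_succ_apply' f n p, ← Function.iterate_succ_apply' f (n + 1) p]
      exact iterate_le_nfp f p _
    have hlt : nfp f p < o := nfp_lt_ord ho hfo hp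
    refine ⟨nfp f p, ⟨hE.2.1 _ hlt ?_ fun q hq ↦ ?_, fun q hq ↦ ?_⟩, le_nfp f p⟩
    · obtain ⟨-, s, -, h1, h2⟩ := hf p hp
      exact (pos_of_gt ((h1.trans h2).trans_le (iterate_le_nfp f p 1))).ne'
    · obtain ⟨t, ht, hlt, s, hs, h1, h2⟩ := hnext q hq
      exact ⟨t, ht, h1.trans h2, hlt⟩
    · obtain ⟨t, ht, hlt, s, hs, h1, h2⟩ := hnext q hq
      exact ⟨s, hs, h1, h2.trans hlt⟩

theorem IsCofinalIn.mk_eq {κ : Cardinal.{0}} (hκ : κ.IsRegular) {X : Set Ordinal.{0}}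
    (hX : IsCofinalIn X κ.ord) : #X = Cardinal.lift.{1} κ := by
  apply le_antisymm
  · exact (mk_le_mk_of_subset hX.1).trans (by simp [Cardinal.mk_Iio_ordinal])
  · by_contra! hlt
    have hsup : sSup X < κ.ord :=
      sSup_lt_of_lt_cof (by rwa [← lift_cof, hκ.cof_ord]) hX.1
    have hlim : Order.IsSuccLimit κ.ord := isSuccLimit_ord hκ.1
    obtain ⟨q, hq, h⟩ := hX.2 _ (hlim.succ_lt hsup)
    exact (Order.succ_le_iff.1 h).not_ge (le_csSup ⟨κ.ord, fun x hx ↦ (hX.1 hx).le⟩ hq)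

/-- If fewer than `κ` sets cover a final segment of the regular cardinal `κ`, then one of them
is unbounded in `κ`. -/
theorem exists_unbounded_of_cover {κ : Cardinal.{0}} (hκ : κ.IsRegular) {ι : Type}
    (hι : #ι < κ) (P : ι → Set Ordinal.{0}) {p : Ordinal.{0}} (hp : p < κ.ord)
    (h : ∀ i, p < i → i < κ.ord → ∃ t, i ∈ P t) :
    ∃ t, ∀ q < κ.ord, ∃ i ∈ P t, q ≤ i ∧ i < κ.ord := by
  by_contra! hcon
  choose b hb hb' using hcon
  have hsup : ⨆ t, b t < κ.ord := iSup_lt_of_lt_cof (by rwa [hκ.cof_ord]) hb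
  have hlim : Order.IsSuccLimit κ.ord := isSuccLimit_ord hκ.1
  have hi := hlim.succ_lt (max_lt hp hsup)
  obtain ⟨t, ht⟩ := h _ ((le_max_left _ _).trans_lt (Order.lt_succ _)) hi
  refine (hb' t _ ht ?_).not_gt hi
  exact ((Ordinal.le_iSup b t).trans (le_max_right _ _)).trans (Order.le_succ _)

theorem slices_stationary_uncountable_cof (lam : Cardinal.{0})
    (h1 : Cardinal.aleph0 < lam.ord.cof) (h2 : lam.ord.cof < lam)
    (e : Ordinal.{0} → Set Ordinal.{0})
    (he1 : ∀ δ, δ < (Order.succ lam).ord → Ordinal.cof δ = lam.ord.cof →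
      IsClubIn (e δ) δ ∧ Nonempty ((e δ) ≃o Set.Iio lam.ord.cof.ord))
    (he2 : ∀ E : Set Ordinal, IsClubIn E (Order.succ lam).ord →
      IsStationaryIn
        {δ | δ < (Order.succ lam).ord ∧ Ordinal.cof δ = lam.ord.cof ∧
          sSup (Ordinal.cof '' (e δ ∩ E)) = lam}
        (Order.succ lam).ord)
    (C : Ordinal.{0} → Set Ordinal.{0})
    (hC : ∀ α, α < (Order.succ lam).ord →
      IsGreatest (C (α + 1)) α ∧
      IsClubIn (C α) α ∧ Cardinal.mk (C α) < Cardinal.lift.{1} lam ∧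
      (∀ δ ∈ C α, Ordinal.cof δ = lam.ord.cof → e δ ⊆ C α))
    (A B : Set Ordinal.{0})
    (hA : IsCofinalIn A (Order.succ lam).ord) (hB : IsCofinalIn B (Order.succ lam).ord)
    (θ : Cardinal.{0}) (hθ : θ < lam) :
    IsStationaryIn
      {ε | ε < (Order.succ lam).ord ∧ θ < Ordinal.cof ε ∧
        ∃ k₁ k₂ : ℕ, ∃ η < ε,
          Cardinal.mk (walkSlice C B k₁ η ε) = Cardinal.lift.{1} (Order.succ lam) ∧
          Cardinal.mk (walkSlice C A k₂ η ε) = Cardinal.lift.{1} (Order.succ lam)}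
      (Order.succ lam).ord := by
  set o := (Order.succ lam).ord with ho
  have hlam : ℵ₀ ≤ lam := h1.le.trans h2.le
  have hreg : (Order.succ lam).IsRegular := isRegular_succ hlam
  have hocof : ℵ₀ < cof o := by
    rw [ho, hreg.cof_ord]
    exact hlam.trans_lt (Order.lt_succ lam)
  have holim : Order.IsSuccLimit o := one_lt_cof_iff.1 (one_lt_aleph0.trans hocof)
  have hclub : ∀ α < o, IsClubIn (C α) α := fun α hα ↦ (hC α hα).2.1
  have hbound : ∀ δ β, cof δ = lam.ord.cof → δ < β → β < o →
      ∃ γ < δ, ∃ μ < lam, ∀ ε ∈ e δ, γ < ε → μ < cof ε → trMaxSup C ε β < ε :=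
    fun δ β hδ hδβ hβ ↦ exists_bound_trMaxSup_lt hclub
      (fun α hα ↦ (hC α hα).2.2.1) (fun α hα ↦ (hC α hα).2.2.2) hδ
      (cof_pos.1 (hδ ▸ aleph0_pos.trans h1)) (he1 δ (hδβ.trans hβ) hδ).1.1 hδβ hβ
  have hselect : ∀ E δ γ μ, δ < o → cof δ = lam.ord.cof → sSup (cof '' (e δ ∩ E)) = lam →
      γ < δ → μ < lam → ∃ ε ∈ e δ, ε ∈ E ∧ γ < ε ∧ μ < cof ε :=
    fun E δ γ μ hδ hδcof hs hγ hμ ↦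
      exists_mem_inter_lt_cof h1 h2 hδ hδcof (he1 δ hδ hδcof).1 (he1 δ hδ hδcof).2.some hs hγ hμ
  refine ⟨fun ε hε ↦ hε.1, fun E hE ↦ ?_⟩
  have hE' := hE.inter_limits hocof (he2 E hE).1 fun p hp ↦ (he2 E hE).exists_gt holim hp
  set E' := {x ∈ E | ∀ p < x, ∃ s ∈ {δ | δ < o ∧ cof δ = lam.ord.cof ∧
    sSup (cof '' (e δ ∩ E)) = lam}, p < s ∧ s < x}
  obtain ⟨δ, ⟨hδ, hδcof, hδs⟩, -⟩ := (he2 E' hE').exists_gt holim (p := 0) (pos_iff_ne_zero.2 holim.ne_bot)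
  have hpair : ∀ α β, δ < α → α < o → δ < β → β < o → ∃ ε ∈ E, ε < δ ∧ θ < cof ε ∧
      ∃ η < ε, trMaxSup C ε α = η ∧ trMaxSup C ε β = η := by
    intro α β hδα hα hδβ hβ
    obtain ⟨γ₁, hγ₁, μ₁, hμ₁, H₁⟩ := hbound δ α hδcof hδα hα
    obtain ⟨γ₂, hγ₂, μ₂, hμ₂, H₂⟩ := hbound δ β hδcof hδβ hβ
    obtain ⟨ε, hεe, hεE', hγε, hμε⟩ :=
      hselect E' δ (max γ₁ γ₂) (max μ₁ μ₂) hδ hδcof hδs (max_lt hγ₁ hγ₂) (max_lt hμ₁ hμ₂)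
    rw [max_lt_iff] at hγε hμε
    have hη₁ := H₁ ε hεe hγε.1 hμε.1
    have hη₂ := H₂ ε hεe hγε.2 hμε.2
    have hεδ : ε < δ := (he1 δ hδ hδcof).1.1 hεe
    have hεo : ε < o := hεδ.trans hδ
    obtain ⟨p, hpC, hp⟩ := (hclub ε hεo).2.2 _ (max_lt hη₁ hη₂)
    rw [max_le_iff] at hp
    obtain ⟨δ', ⟨hδ'o, hδ'cof, hδ's⟩, hpδ', hδ'ε⟩ := hεE'.2 p ((hclub ε hεo).1 hpC)
    obtain ⟨γ, hγ, μ, hμ, H⟩ := hbound δ' ε hδ'cof hδ'ε hεo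
    obtain ⟨ε', hε'e, hε'E, hγε', hμε'⟩ :=
      hselect E δ' (max γ p) (max μ θ) hδ'o hδ'cof hδ's (max_lt hγ hpδ') (max_lt hμ hθ)
    rw [max_lt_iff] at hγε' hμε'
    have hη := H ε' hε'e hγε'.1 hμε'.1
    have hε'ε : ε' < ε := ((he1 δ' hδ'o hδ'cof).1.1 hε'e).trans hδ'ε
    have hpη : p ≤ trMaxSup C ε' ε := by
      rw [trMaxSup_of_lt hclub hε'ε hεo]
      exact le_max_of_le_left (le_csSup (bddAbove_inter_Iio _ _) ⟨hpC, hγε'.2⟩)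
    refine ⟨ε', hε'E, hε'ε.trans hεδ, hμε'.2, _, hη, ?_, ?_⟩
    · rw [trMaxSup_eq_max hclub hε'ε.le (hεδ.trans hδα).le hα (hp.1.trans_lt hγε'.2),
        max_eq_right (hp.1.trans hpη)]
    · rw [trMaxSup_eq_max hclub hε'ε.le (hεδ.trans hδβ).le hβ (hp.2.trans_lt hγε'.2),
        max_eq_right (hp.2.trans hpη)]
  choose! a haA hia using hA.2
  choose! b hbB hib using hB.2
  have hcardδ : #δ.ToType ≤ lam := by
    rw [mk_toType]
    exact Order.lt_succ_iff.1 (lt_ord.1 hδ)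
  have hι : #(δ.ToType × δ.ToType × ℕ × ℕ) < Order.succ lam := by
    rw [Order.lt_succ_iff]
    simp only [mk_prod, Cardinal.lift_id, mk_nat, aleph0_mul_aleph0]
    calc #δ.ToType * (#δ.ToType * ℵ₀) ≤ lam * (lam * lam) := by gcongr
      _ = lam := by simp [mul_eq_self hlam]
  obtain ⟨⟨x, y, k₁, k₂⟩, hu⟩ := exists_unbounded_of_cover hreg hι
    (fun t ↦ {i | (t.1.toOrd : Ordinal) ∈ E ∧ θ < cof (t.1.toOrd : Ordinal) ∧
      (t.2.1.toOrd : Ordinal) < t.1.toOrd ∧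
      b i ∈ walkSlice C B t.2.2.1 t.2.1.toOrd t.1.toOrd ∧
      a i ∈ walkSlice C A t.2.2.2 t.2.1.toOrd t.1.toOrd}) hδ (by
    intro i hδi hi
    obtain ⟨ε, hεE, hεδ, hθε, η, hη, hα, hβ⟩ := hpair (a i) (b i) (hδi.trans_le (hia i hi))
      (hA.1 (haA i hi)) (hδi.trans_le (hib i hi)) (hB.1 (hbB i hi))
    refine ⟨(ToType.mk ⟨ε, hεδ⟩, ToType.mk ⟨η, hη.trans hεδ⟩, rho C ε (b i), rho C ε (a i)), ?_⟩
    simp only [ToType.toOrd, OrderIso.symm_apply_apply, mem_ofPred_eq]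
    exact ⟨hεE, hθε, hη, ⟨hbB i hi, hεδ.trans (hδi.trans_le (hib i hi)), rfl, hβ⟩,
      haA i hi, hεδ.trans (hδi.trans_le (hia i hi)), rfl, hα⟩)
  obtain ⟨i₀, ⟨hxE, hθx, hyx, -, -⟩, -, -⟩ := hu 0 (pos_of_gt hδ)
  refine ⟨x.toOrd, ⟨hE.1 hxE, hθx, k₁, k₂, y.toOrd, hyx, ?_, ?_⟩, hxE⟩
  · refine IsCofinalIn.mk_eq hreg ⟨fun z hz ↦ hB.1 hz.1, fun q hq ↦ ?_⟩
    obtain ⟨i, hi, hqi, hio⟩ := hu q hq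
    exact ⟨b i, hi.2.2.2.1, hqi.trans (hib i hio)⟩
  · refine IsCofinalIn.mk_eq hreg ⟨fun z hz ↦ hA.1 hz.1, fun q hq ↦ ?_⟩
    obtain ⟨i, hi, hqi, hio⟩ := hu q hq
    exact ⟨a i, hi.2.2.2.2, hqi.trans (hia i hio)⟩
end

section
/- Let λ be a cardinal with λ > cf(λ) = ω, with ⟨μ_m : m < ω⟩, ⟨e^m_δ : δ ∈ E^{λ⁺}_{ω₁}, m < ω⟩ an off-center club guessing system (the μ_m an increasing sequence of successor cardinals with supremum λ; each ⟨e^m_δ : m < ω⟩ an ⊆-increasing chain of clubs in δ with |e^m_δ| ≤ μ_m; and for every club E ⊆ λ⁺ stationarily many δ ∈ E^{λ⁺}_{ω₁} with sup(e^m_δ ∩ E ∩ E^δ_{>μ_m}) = δ for all m), and let ⟨C^m_α : α < λ⁺, m < ω⟩ satisfy: max(C^m_{α+1}) = α, ⟨C^m_α : m < ω⟩ an ⊆-increasing chain of clubs in α, |C^m_α| ≤ max{μ_m, cf(α)}, and δ ∈ C^m_α ∩ E^{λ⁺}_{ω₁} implies e^m_δ ⊆ C^m_α. Then for all cofinal subsets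 A, B of λ⁺ and every cardinal θ < λ, the set S^{A,B}_{>θ} := {ε ∈ E^{λ⁺}_{>θ} : there exist σ₁, σ₂ ∈ ω^{<ω} and η < ε with |B_{σ₁,η}(ε)| = |A_{σ₂,η}(ε)| = λ⁺} is stationary in λ⁺. -/
open Ordinal Cardinal Set

/-- `lift σ : ω → ω` for a (nonempty) finite sequence `σ`: `lift σ n = σ n` for
`n ∈ dom σ`, and `lift σ n = σ (max (dom σ))` (the last entry) otherwise. -/
def liftSeq (σ : List ℕ) (n : ℕ) : ℕ := σ.getD n (σ.getLastD 0)

/-- The generalized `(C,σ)`-walk: `gwalk C σ α β n` is the `n`-th step `β_n` of the walk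
from `β` down to `α`, where `β_{n+1} = min (C^{lift σ n}_{β_n} \ α)`
(it stabilizes once it reaches `α`). -/
noncomputable def gwalk (C : Ordinal.{0} → ℕ → Set Ordinal.{0}) (σ : List ℕ)
    (α β : Ordinal.{0}) : ℕ → Ordinal.{0}
  | 0 => β
  | n + 1 =>
      let b := gwalk C σ α β n
      if α < b then sInf (C b (liftSeq σ n) ∩ Set.Ici α) else b

/-- `ρ_σ(α,β)`: the length of the `(C,σ)`-walk from `β` down to `α`. -/
noncomputable def grho (C : Ordinal.{0} → ℕ → Set Ordinal.{0}) (σ : List ℕ)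
    (α β : Ordinal.{0}) : ℕ :=
  sInf {k | gwalk C σ α β k = α}

/-- `max {sup (C^i_τ ∩ ε) : (i,τ) ∈ tr°_σ(ε,β)}`, the maximum over the trace
`tr°_σ(ε,β) = {(lift σ i, β_i) : i < ρ_σ(ε,β)}` of the `(C,σ)`-walk from `β` down to `ε`. -/
noncomputable def gtrMaxSup (C : Ordinal.{0} → ℕ → Set Ordinal.{0}) (σ : List ℕ)
    (ε β : Ordinal.{0}) : Ordinal.{0} :=
  ⨆ i : Fin (grho C σ ε β), sSup (C (gwalk C σ ε β i) (liftSeq σ i) ∩ Set.Iio ε)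

/-- `A_{σ,η}(ε) = {α ∈ A : α > ε, ρ_σ(ε,α) = ℓ(σ),
max {sup (C^i_τ ∩ ε) : (i,τ) ∈ tr°_σ(ε,α)} = η}`. -/
def gwalkSlice (C : Ordinal.{0} → ℕ → Set Ordinal.{0}) (A : Set Ordinal.{0}) (σ : List ℕ)
    (η ε : Ordinal.{0}) : Set Ordinal.{0} :=
  {α ∈ A | ε < α ∧ grho C σ ε α = σ.length ∧ gtrMaxSup C σ ε α = η}

/-- `WalkTo C ε β σ η`: stepping down from `β` towards `ε`, choosing the clubs according to the
successive entries of `σ`, one arrives at `ε` exactly when `σ` is exhausted, and `η` is the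
maximum of the suprema below `ε` of the clubs used on the way. -/
inductive WalkTo (C : Ordinal.{0} → ℕ → Set Ordinal.{0}) (ε : Ordinal.{0}) :
    Ordinal.{0} → List ℕ → Ordinal.{0} → Prop
  | nil : WalkTo C ε ε [] 0
  | cons {β : Ordinal.{0}} {i : ℕ} {σ : List ℕ} {η : Ordinal.{0}} (hlt : ε < β)
      (tail : WalkTo C ε (sInf (C β i ∩ Ici ε)) σ η) :
      WalkTo C ε β (i :: σ) (max (sSup (C β i ∩ Iio ε)) η)

theorem liftSeq_cons_succ (i : ℕ) (σ : List ℕ) {n : ℕ} (hn : n < σ.length) :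
    liftSeq (i :: σ) (n + 1) = liftSeq σ n := by
  simp [liftSeq, hn]

theorem gwalk_cons_succ (C : Ordinal.{0} → ℕ → Set Ordinal.{0}) (i : ℕ) (σ : List ℕ)
    {ε β : Ordinal.{0}} (hlt : ε < β) {n : ℕ} (hn : n ≤ σ.length) :
    gwalk C (i :: σ) ε β (n + 1) = gwalk C σ ε (sInf (C β i ∩ Ici ε)) n := by
  induction n with
  | zero => simp [gwalk, hlt, liftSeq]
  | succ n ih =>
    rw [gwalk, ih (by omega), liftSeq_cons_succ i σ (by omega)]
    rfl

theorem WalkTo.gwalk_spec {C : Ordinal.{0} → ℕ → Set Ordinal.{0}} {ε β η : Ordinal.{0}}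
    {σ : List ℕ} (h : WalkTo C ε β σ η) :
    gwalk C σ ε β σ.length = ε ∧ ∀ n < σ.length, gwalk C σ ε β n ≠ ε := by
  induction h with
  | nil => simp [gwalk]
  | @cons β i σ η hlt _ ih =>
    refine ⟨?_, ?_⟩
    · rw [List.length_cons, gwalk_cons_succ C i σ hlt le_rfl, ih.1]
    · rintro (_ | n) hn
      · simpa [gwalk] using hlt.ne'
      · rw [List.length_cons] at hn
        rw [gwalk_cons_succ C i σ hlt (by omega)]
        exact ih.2 n (by omega)

theorem WalkTo.grho_eq {C : Ordinal.{0} → ℕ → Set Ordinal.{0}} {ε β η : Ordinal.{0}}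
    {σ : List ℕ} (h : WalkTo C ε β σ η) : grho C σ ε β = σ.length :=
  IsLeast.csInf_eq ⟨h.gwalk_spec.1, fun n hn => by
    by_contra! hlt
    exact h.gwalk_spec.2 n hlt hn⟩

theorem WalkTo.iSup_trace {C : Ordinal.{0} → ℕ → Set Ordinal.{0}} {ε β η : Ordinal.{0}}
    {σ : List ℕ} (h : WalkTo C ε β σ η) :
    ⨆ i : Fin σ.length, sSup (C (gwalk C σ ε β i) (liftSeq σ i) ∩ Iio ε) = η := by
  induction h with
  | nil => simp
  | @cons β i σ η hlt _ ih =>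
    rw [← ih]
    have hbdd {k : ℕ} (f : Fin k → Ordinal.{0}) : BddAbove (range f) := (finite_range f).bddAbove
    have htail (n : Fin σ.length) :
        sSup (C (gwalk C (i :: σ) ε β (n + 1)) (liftSeq (i :: σ) (n + 1)) ∩ Iio ε) =
          sSup (C (gwalk C σ ε (sInf (C β i ∩ Ici ε)) n) (liftSeq σ n) ∩ Iio ε) := by
      rw [gwalk_cons_succ C i σ hlt n.2.le, liftSeq_cons_succ i σ n.2]
    refine le_antisymm (ciSup_le' fun n => ?_) (max_le ?_ (ciSup_le' fun n => ?_))
    · refine Fin.cases (le_max_left _ _) (fun n => ?_) n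
      rw [Fin.val_succ, htail]
      exact (le_ciSup (hbdd _) n).trans (le_max_right _ _)
    · exact le_ciSup (hbdd fun n : Fin (i :: σ).length =>
        sSup (C (gwalk C (i :: σ) ε β n) (liftSeq (i :: σ) n) ∩ Iio ε)) 0
    · rw [← htail]
      exact le_ciSup (hbdd fun n : Fin (i :: σ).length =>
        sSup (C (gwalk C (i :: σ) ε β n) (liftSeq (i :: σ) n) ∩ Iio ε)) n.succ

theorem WalkTo.mem_gwalkSlice {C : Ordinal.{0} → ℕ → Set Ordinal.{0}} {A : Set Ordinal.{0}}
    {ε α η : Ordinal.{0}} {σ : List ℕ} (h : WalkTo C ε α σ η) (hα : α ∈ A) (hlt : ε < α) :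
    α ∈ gwalkSlice C A σ η ε := by
  refine ⟨hα, hlt, h.grho_eq, ?_⟩
  rw [gtrMaxSup, h.grho_eq]
  exact h.iSup_trace

/-- A set with supremum below `γ` at most `η` has no points in the interval `(η, γ)`. -/
theorem notMem_of_sSup_inter_Iio_le {S : Set Ordinal.{0}} {γ η x : Ordinal.{0}}
    (h : sSup (S ∩ Iio γ) ≤ η) (hη : η < x) (hx : x < γ) : x ∉ S := fun hS =>
  ((le_csSup (bddAbove_Iio.mono inter_subset_right) ⟨hS, hx⟩).trans h).not_gt hη

theorem inter_Ici_eq_of_sSup_le {S : Set Ordinal.{0}} {γ η ε : Ordinal.{0}}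
    (h : sSup (S ∩ Iio γ) ≤ η) (hη : η < ε) (hε : ε ≤ γ) : S ∩ Ici ε = S ∩ Ici γ := by
  ext x
  refine ⟨fun hx => ⟨hx.1, ?_⟩, fun hx => ⟨hx.1, hε.trans hx.2⟩⟩
  by_contra! hlt
  exact notMem_of_sSup_inter_Iio_le h (hη.trans_le hx.2) (by simpa using hlt) hx.1

theorem inter_Iio_eq_of_sSup_le {S : Set Ordinal.{0}} {γ η ε : Ordinal.{0}}
    (h : sSup (S ∩ Iio γ) ≤ η) (hη : η < ε) (hε : ε ≤ γ) : S ∩ Iio ε = S ∩ Iio γ := by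
  ext x
  refine ⟨fun hx => ⟨hx.1, lt_of_lt_of_le hx.2 hε⟩, fun hx => ⟨hx.1, ?_⟩⟩
  by_contra! hle
  exact notMem_of_sSup_inter_Iio_le h (hη.trans_le (by simpa using hle)) hx.2 hx.1

/-- Walks concatenate: a walk from `β` to `γ` whose clubs are bounded by `η` below `γ` is an
initial part of the walk to any `ε` in `(η, γ)`. -/
theorem WalkTo.append {C : Ordinal.{0} → ℕ → Set Ordinal.{0}} {γ β η ε η' : Ordinal.{0}}
    {σ τ : List ℕ} (h : WalkTo C γ β σ η) (hη : η < ε) (hε : ε < γ) (h' : WalkTo C ε γ τ η') :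
    WalkTo C ε β (σ ++ τ) (max η η') := by
  induction h with
  | nil => simpa using h'
  | @cons β i σ η hlt _ ih =>
    have hη₁ := (le_max_left _ _).trans_lt hη
    have ih := ih ((le_max_right _ _).trans_lt hη)
    rw [← inter_Ici_eq_of_sSup_le le_rfl hη₁ hε.le] at ih
    rw [← inter_Iio_eq_of_sSup_le le_rfl hη₁ hε.le, max_assoc]
    exact .cons (hε.trans hlt) ih

theorem sSup_inter_Iio_lt_of_isClosedIn {S : Set Ordinal.{0}} {β δ : Ordinal.{0}}
    (hS : IsClosedIn S β) (hδ : δ < β) (hδ₀ : δ ≠ 0) (hmem : δ ∉ S) : sSup (S ∩ Iio δ) < δ := by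
  by_contra! hle
  refine hmem (hS δ hδ hδ₀ fun q hq => ?_)
  obtain ⟨r, hr, hqr⟩ := exists_lt_of_lt_csSup' (hq.trans_le hle)
  exact ⟨r, hr.1, hqr, hr.2⟩

theorem sSup_inter_Iio_lt_of_mk_le {S : Set Ordinal.{0}} {ε : Ordinal.{0}} {c : Cardinal.{0}}
    (hS : #S ≤ Cardinal.lift.{1} c) (hc : c < ε.cof) : sSup (S ∩ Iio ε) < ε := by
  refine Ordinal.sSup_lt_of_lt_cof ?_ fun x hx => hx.2
  refine ((mk_le_mk_of_subset inter_subset_left).trans hS).trans_lt ?_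
  rwa [← Ordinal.lift_cof, Cardinal.lift_lt]

/-- The walk from `β` to a point `δ` of cofinality `ω₁` determines walks from `β` to all
sufficiently large points of high cofinality of `e δ m`, for all large `m`. -/
theorem exists_walkTo_mem_club {K : Ordinal.{0}} {μ : ℕ → Cardinal.{0}} (hμ : Monotone μ)
    {e C : Ordinal.{0} → ℕ → Set Ordinal.{0}}
    (hcof : ∀ β < K, ∃ m, Ordinal.cof β ≤ μ m)
    (hC : ∀ α < K, ∀ m : ℕ, IsClubIn (C α m) α ∧ C α m ⊆ C α (m + 1) ∧
      #(C α m) ≤ Cardinal.lift.{1} (max (μ m) (Ordinal.cof α)) ∧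
      ∀ δ ∈ C α m, Ordinal.cof δ = ℵ_ 1 → e δ m ⊆ C α m)
    {δ : Ordinal.{0}} (hδ : Ordinal.cof δ = ℵ_ 1) (he : ∀ m, e δ m ⊆ Iio δ)
    (β : Ordinal.{0}) (hβ : β < K) (hδβ : δ < β) :
    ∃ m₀ : ℕ, ∃ σ : List ℕ, ∃ η < δ, ∀ m ≥ m₀, ∀ ε ∈ e δ m, μ m < Ordinal.cof ε → η < ε →
      ∃ η' < ε, WalkTo C ε β (σ ++ [m]) η' ∧ sSup (e δ m ∩ Iio ε) ≤ η' := by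
  have hδ₀ : δ ≠ 0 := by
    rintro rfl
    rw [Ordinal.cof_zero] at hδ
    exact (aleph_pos 1).ne hδ
  induction β using WellFoundedLT.induction with
  | ind β ih =>
    have hclub := (hC β hβ 0).1
    obtain ⟨q, hq, hδq⟩ := hclub.2.2 δ hδβ
    have hmem : sInf (C β 0 ∩ Ici δ) ∈ C β 0 ∩ Ici δ := csInf_mem ⟨q, hq, hδq⟩
    set β₁ := sInf (C β 0 ∩ Ici δ) with hβ₁
    obtain heq | hlt := (mem_Ici.1 hmem.2).eq_or_lt
    · obtain ⟨m₀, hm₀⟩ := hcof β hβ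
      refine ⟨m₀, [], 0, pos_iff_ne_zero.2 hδ₀, fun m hm ε hε hcε hε₀ => ?_⟩
      have hmono : Monotone (C β) := monotone_nat_of_le_succ fun n => (hC β hβ n).2.1
      have hsub : e δ m ⊆ C β m :=
        (hC β hβ m).2.2.2 δ (hmono (Nat.zero_le m) (heq ▸ hmem.1)) hδ
      have hmin : sInf (C β m ∩ Ici ε) = ε :=
        IsLeast.csInf_eq ⟨⟨hsub hε, self_mem_Ici⟩, fun _ hx => hx.2⟩
      have hsup : sSup (C β m ∩ Iio ε) < ε :=
        sSup_inter_Iio_lt_of_mk_le (hC β hβ m).2.2.1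
          (max_lt hcε ((hm₀.trans (hμ hm)).trans_lt hcε))
      refine ⟨max (sSup (C β m ∩ Iio ε)) 0, max_lt hsup hε₀,
        .cons ((he m hε).trans hδβ) (hmin.symm ▸ .nil), ?_⟩
      exact (csSup_le_csSup' (bddAbove_Iio.mono inter_subset_right)
        (inter_subset_inter_left _ hsub)).trans (le_max_left _ _)
    · have hβ₁β : β₁ < β := hclub.1 hmem.1
      obtain ⟨m₀, σ, η, hη, hwalk⟩ := ih β₁ hβ₁β (hβ₁β.trans hβ) hlt
      have hnot : δ ∉ C β 0 := fun h =>
        (csInf_le' (s := C β 0 ∩ Ici δ) ⟨h, self_mem_Ici⟩).not_gt hlt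
      have hsup := sSup_inter_Iio_lt_of_isClosedIn hclub.2.1 hδβ hδ₀ hnot
      refine ⟨m₀, 0 :: σ, max (sSup (C β 0 ∩ Iio δ)) η, max_lt hsup hη,
        fun m hm ε hε hcε hηε => ?_⟩
      have hη₁ := (le_max_left _ _).trans_lt hηε
      obtain ⟨η', hη', hw, hle⟩ := hwalk m hm ε hε hcε ((le_max_right _ _).trans_lt hηε)
      have hεδ : ε < δ := he m hε
      rw [hβ₁, ← inter_Ici_eq_of_sSup_le le_rfl hη₁ hεδ.le] at hw
      refine ⟨_, ?_, .cons (hεδ.trans hδβ) hw, hle.trans (le_max_right _ _)⟩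
      rw [inter_Iio_eq_of_sSup_le le_rfl hη₁ hεδ.le]
      exact max_lt hη₁ hη'

theorem exists_gt_of_isStationaryIn {G : Set Ordinal.{0}} {K : Ordinal.{0}}
    (hK : Order.IsSuccLimit K) (hG : IsStationaryIn G K) {p : Ordinal.{0}} (hp : p < K) :
    ∃ g ∈ G, p < g ∧ g < K := by
  have hclub : IsClubIn (Ioo p K) K := by
    refine ⟨fun x hx => hx.2, fun x hx hx₀ h => ?_, fun q hq => ?_⟩
    · obtain ⟨r, hr, -, hrx⟩ := h 0 (pos_iff_ne_zero.2 hx₀)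
      exact ⟨hr.1.trans hrx, hx⟩
    · have hlt := hK.succ_lt (max_lt hp hq)
      exact ⟨_, ⟨(le_max_left p q).trans_lt (Order.lt_succ _), hlt⟩,
        (le_max_right p q).trans (Order.le_succ _)⟩
  obtain ⟨g, hg, hgc⟩ := hG.2 _ hclub
  exact ⟨g, hg, hgc⟩

/-- The limit points of an unbounded subset of an ordinal of uncountable cofinality form a
club. -/
theorem isClubIn_limitPoints {G : Set Ordinal.{0}} {K : Ordinal.{0}} (hK : ℵ₀ < K.cof)
    (hG : ∀ p < K, ∃ g ∈ G, p < g ∧ g < K) :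
    IsClubIn {γ | γ < K ∧ ∀ q < γ, ∃ g ∈ G, q < g ∧ g < γ} K := by
  refine ⟨fun x hx => hx.1, fun p hp _ h => ⟨hp, fun q hq => ?_⟩, fun p hp => ?_⟩
  · obtain ⟨r, hr, hqr, hrp⟩ := h q hq
    obtain ⟨g, hg, hqg, hgr⟩ := hr.2 q hqr
    exact ⟨g, hg, hqg, hgr.trans hrp⟩
  · choose! f hfG hlt hfK using hG
    have hiter (n : ℕ) : f^[n] p < K := by
      induction n with
      | zero => exact hp
      | succ n ih => rw [Function.iterate_succ_apply']; exact hfK _ ih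
    have hbdd : BddAbove (range fun n => f^[n] p) := ⟨K, by
      rintro _ ⟨n, rfl⟩
      exact (hiter n).le⟩
    refine ⟨⨆ n, f^[n] p, ⟨Ordinal.iSup_lt_of_lt_cof (by simpa using hK) hiter,
      fun q hq => ?_⟩, le_ciSup hbdd 0⟩
    obtain ⟨n, hn⟩ := exists_lt_of_lt_ciSup' hq
    have hstep (k : ℕ) : f^[k] p < f^[k + 1] p := by
      rw [Function.iterate_succ_apply']
      exact hlt _ (hiter k)
    refine ⟨f^[n + 1] p, ?_, hn.trans (hstep n), (hstep (n + 1)).trans_le (le_ciSup hbdd (n + 2))⟩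
    rw [Function.iterate_succ_apply']
    exact hfG _ (hiter n)

/-- A decreasing property of ordinals below `K` that is witnessed everywhere by fewer than `cof K`
many witnesses is witnessed everywhere by a single one. -/
theorem exists_uniform_of_mk_lt_cof {T : Type 1} {K : Ordinal.{0}}
    (hT : #T < Cardinal.lift.{1} K.cof) {P : T → Ordinal.{0} → Prop}
    (hanti : ∀ t p q, p ≤ q → P t q → P t p) (h : ∀ p < K, ∃ t, P t p) :
    ∃ t, ∀ p < K, P t p := by
  by_contra! hcon
  choose f hfK hf using hcon
  have hlt : sSup (range f) < K := by
    refine Ordinal.sSup_lt_of_lt_cof ?_ (by rintro _ ⟨t, rfl⟩; exact hfK t)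
    rw [← Ordinal.lift_cof]
    exact mk_range_le.trans_lt hT
  have hbdd : BddAbove (range f) := ⟨K, by rintro _ ⟨t, rfl⟩; exact (hfK t).le⟩
  obtain ⟨t, ht⟩ := h _ hlt
  exact hf t (hanti t _ _ (le_csSup hbdd ⟨t, rfl⟩) ht)

theorem mk_eq_of_unbounded {X : Set Ordinal.{0}} {c : Cardinal.{0}} (hc : c.IsRegular)
    (hX : X ⊆ Iio c.ord) (hunb : ∀ p < c.ord, ∃ x ∈ X, p ≤ x) : #X = Cardinal.lift.{1} c := by
  refine le_antisymm ((mk_le_mk_of_subset hX).trans (by simp [Cardinal.mk_Iio_ordinal])) ?_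
  by_contra! hlt
  have hsup : sSup X < c.ord := by
    refine Ordinal.sSup_lt_of_lt_cof ?_ hX
    rwa [← Ordinal.lift_cof, hc.cof_ord]
  obtain ⟨x, hx, hle⟩ := hunb _ ((isSuccLimit_ord hc.aleph0_le).succ_lt hsup)
  exact ((Order.lt_succ _).trans_le hle).not_ge (le_csSup (bddAbove_Iio.mono hX) hx)

theorem cof_lt_of_lt_ord_succ_s12 {lam : Cardinal.{0}} (hsing : lam.ord.cof < lam) {β : Ordinal.{0}}
    (hβ : β < (Order.succ lam).ord) : β.cof < lam := by
  refine lt_of_le_of_ne (β.cof_le_card.trans (Order.lt_succ_iff.1 (lt_ord.1 hβ))) fun h => ?_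
  have := Ordinal.cof_ord_cof β
  rw [h] at this
  exact hsing.ne this

theorem slices_stationary_countable_cof (lam : Cardinal.{0})
    (h1 : lam.ord.cof = Cardinal.aleph0) (h2 : Cardinal.aleph0 < lam)
    (μ : ℕ → Cardinal.{0}) (e : Ordinal.{0} → ℕ → Set Ordinal.{0})
    (hμ1 : StrictMono μ)
    (hμ2 : ∀ m, ∃ ν : Cardinal, Cardinal.aleph0 ≤ ν ∧ μ m = Order.succ ν)
    (hμ3 : (⨆ m, μ m) = lam)
    (he1 : ∀ δ, δ < (Order.succ lam).ord → Ordinal.cof δ = Cardinal.aleph 1 →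
      ∀ m : ℕ, IsClubIn (e δ m) δ ∧ e δ m ⊆ e δ (m + 1) ∧
        Cardinal.mk (e δ m) ≤ Cardinal.lift.{1} (μ m))
    (he2 : ∀ E : Set Ordinal, IsClubIn E (Order.succ lam).ord →
      IsStationaryIn
        {δ | δ < (Order.succ lam).ord ∧ Ordinal.cof δ = Cardinal.aleph 1 ∧
          ∀ m : ℕ, sSup (e δ m ∩ E ∩ {α | μ m < Ordinal.cof α}) = δ}
        (Order.succ lam).ord)
    (C : Ordinal.{0} → ℕ → Set Ordinal.{0})
    (hC : ∀ α, α < (Order.succ lam).ord → ∀ m : ℕ,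
      IsGreatest (C (α + 1) m) α ∧
      IsClubIn (C α m) α ∧ C α m ⊆ C α (m + 1) ∧
      Cardinal.mk (C α m) ≤ Cardinal.lift.{1} (max (μ m) (Ordinal.cof α)) ∧
      (∀ δ ∈ C α m, Ordinal.cof δ = Cardinal.aleph 1 → e δ m ⊆ C α m))
    (A B : Set Ordinal.{0})
    (hA : IsCofinalIn A (Order.succ lam).ord) (hB : IsCofinalIn B (Order.succ lam).ord)
    (θ : Cardinal.{0}) (hθ : θ < lam) :
    IsStationaryIn
      {ε | ε < (Order.succ lam).ord ∧ θ < Ordinal.cof ε ∧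
        ∃ σ₁ σ₂ : List ℕ, ∃ η < ε,
          Cardinal.mk (gwalkSlice C B σ₁ η ε) = Cardinal.lift.{1} (Order.succ lam) ∧
          Cardinal.mk (gwalkSlice C A σ₂ η ε) = Cardinal.lift.{1} (Order.succ lam)}
      (Order.succ lam).ord := by
  have hmono := hμ1.monotone
  have hreg : (Order.succ lam).IsRegular := isRegular_succ h2.le
  have hlim : Order.IsSuccLimit (Order.succ lam).ord := isSuccLimit_ord hreg.aleph0_le
  have hKcof : ℵ₀ < (Order.succ lam).ord.cof := by
    rw [hreg.cof_ord]
    exact h2.trans (Order.lt_succ _)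
  have hμ_ge (c : Cardinal.{0}) (hc : c < lam) : ∃ m, c ≤ μ m := by
    obtain ⟨m, hm⟩ := exists_lt_of_lt_ciSup' (hμ3.symm ▸ hc)
    exact ⟨m, hm.le⟩
  have hwalk (δ : Ordinal.{0}) (hδ : δ < (Order.succ lam).ord) (hcδ : δ.cof = ℵ_ 1) :=
    exists_walkTo_mem_club hmono (fun β hβ => hμ_ge _ (cof_lt_of_lt_ord_succ_s12 (h1 ▸ h2) hβ))
      (fun α hα m => (hC α hα m).2) hcδ (fun m => (he1 δ hδ hcδ m).1.1)
  refine ⟨fun ε hε => hε.1, fun D hD => ?_⟩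
  set G := {δ | δ < (Order.succ lam).ord ∧ Ordinal.cof δ = ℵ_ 1 ∧
    ∀ m : ℕ, sSup (e δ m ∩ D ∩ {α | μ m < Ordinal.cof α}) = δ}
  have hD' := isClubIn_limitPoints hKcof fun p hp =>
    exists_gt_of_isStationaryIn hlim (he2 D hD) hp
  set D' := {γ | γ < (Order.succ lam).ord ∧ ∀ q < γ, ∃ g ∈ G, q < g ∧ g < γ}
  have hguess {δ : Ordinal.{0}} {E : Set Ordinal.{0}} {m : ℕ}
      (h : sSup (e δ m ∩ E ∩ {α | μ m < Ordinal.cof α}) = δ) {q : Ordinal.{0}} (hq : q < δ) :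
      ∃ ε ∈ e δ m, ε ∈ E ∧ μ m < Ordinal.cof ε ∧ q < ε := by
    obtain ⟨ε, hε, hqε⟩ := exists_lt_of_lt_csSup' (h.symm ▸ hq)
    exact ⟨ε, hε.1.1, hε.1.2, hε.2, hqε⟩
  obtain ⟨δ₀, ⟨hδ₀K, hδ₀cof, hδ₀⟩, -⟩ := he2 D' hD' |>.2 _ hD'
  have hpair (α : Ordinal.{0}) (hα : α < (Order.succ lam).ord) (hδα : δ₀ < α)
      (β : Ordinal.{0}) (hβ : β < (Order.succ lam).ord) (hδβ : δ₀ < β) :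
      ∃ σ₁ σ₂ : List ℕ, ∃ η ε, η < ε ∧ ε < δ₀ ∧ ε ∈ D ∧ θ < ε.cof ∧
        WalkTo C ε β σ₁ η ∧ WalkTo C ε α σ₂ η := by
    obtain ⟨ma, σa, ηa, hηa, ha⟩ := hwalk δ₀ hδ₀K hδ₀cof α hα hδα
    obtain ⟨mb, σb, ηb, hηb, hb⟩ := hwalk δ₀ hδ₀K hδ₀cof β hβ hδβ
    obtain ⟨γ, hγe, hγD, hγcof, hγ⟩ := hguess (hδ₀ (max ma mb)) (max_lt hηa hηb)
    obtain ⟨ηa', hηa', wa, -⟩ :=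
      ha _ (le_max_left _ _) γ hγe hγcof ((le_max_left _ _).trans_lt hγ)
    obtain ⟨ηb', hηb', wb, -⟩ :=
      hb _ (le_max_right _ _) γ hγe hγcof ((le_max_right _ _).trans_lt hγ)
    obtain ⟨δ, ⟨hδK, hδcof, hδ⟩, hηδ, hδγ⟩ := hγD.2 _ (max_lt hηa' hηb')
    obtain ⟨m₁, τ, η₁, hη₁, hτ⟩ := hwalk δ hδK hδcof γ hγD.1 hδγ
    obtain ⟨mθ, hmθ⟩ := hμ_ge θ hθ
    set m := max m₁ mθ
    have hclub := (he1 δ hδK hδcof m).1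
    obtain ⟨q, hq, hηq⟩ := hclub.2.2 _ hηδ
    obtain ⟨ε, hεe, hεD, hεcof, hε⟩ := hguess (hδ m) (max_lt hη₁ (hclub.1 hq))
    have hqε : q < ε := (le_max_right _ _).trans_lt hε
    obtain ⟨η, hη, w, hle⟩ := hτ m (le_max_left _ _) ε hεe hεcof ((le_max_left _ _).trans_lt hε)
    have hqη : q ≤ η := (le_csSup (bddAbove_Iio.mono inter_subset_right) ⟨hq, hqε⟩).trans hle
    have hεγ : ε < γ := (hclub.1 hεe).trans hδγ
    have hγδ₀ : γ < δ₀ := (he1 δ₀ hδ₀K hδ₀cof _).1.1 hγe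
    have haq : ηa' ≤ q := (le_max_left _ _).trans hηq
    have hbq : ηb' ≤ q := (le_max_right _ _).trans hηq
    refine ⟨(σb ++ [max ma mb]) ++ (τ ++ [m]), (σa ++ [max ma mb]) ++ (τ ++ [m]), η, ε, hη,
      hεγ.trans hγδ₀, hεD,
      (hmθ.trans (hmono (le_max_right _ _))).trans_lt hεcof, ?_, ?_⟩
    · simpa only [max_eq_right (hbq.trans hqη)] using wb.append (hbq.trans_lt hqε) hεγ w
    · simpa only [max_eq_right (haq.trans hqη)] using wa.append (haq.trans_lt hqε) hεγ w
  have hcard : #(List ℕ × List ℕ × Iio δ₀ × Iio δ₀) <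
      Cardinal.lift.{1} (Order.succ lam).ord.cof := by
    have hinf : ℵ₀ ≤ Cardinal.lift.{1} (Order.succ lam) :=
      aleph0_le_lift.2 hreg.aleph0_le
    have hδ₀card : Cardinal.lift.{1} δ₀.card < Cardinal.lift.{1} (Order.succ lam) :=
      Cardinal.lift_lt.2 (lt_ord.1 hδ₀K)
    have hℵ : ℵ₀ < Cardinal.lift.{1} (Order.succ lam) := by
      simpa using h2.le
    rw [hreg.cof_ord]
    simp only [mk_prod, Cardinal.lift_id, Cardinal.lift_uzero, Cardinal.mk_list_eq_aleph0,
      Cardinal.lift_aleph0, Cardinal.mk_Iio_ordinal]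
    exact mul_lt_of_lt hinf hℵ (mul_lt_of_lt hinf hℵ (mul_lt_of_lt hinf hδ₀card hδ₀card))
  obtain ⟨⟨σ₁, σ₂, η, ε⟩, ht⟩ := exists_uniform_of_mk_lt_cof hcard
    (P := fun t p => t.2.2.1 < t.2.2.2 ∧ (t.2.2.2 : Ordinal) ∈ D ∧ θ < (t.2.2.2 : Ordinal).cof ∧
      (∃ β ∈ gwalkSlice C B t.1 t.2.2.1 t.2.2.2, p ≤ β) ∧
      ∃ α ∈ gwalkSlice C A t.2.1 t.2.2.1 t.2.2.2, p ≤ α)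
    (fun t p q hpq ⟨hlt, hmem, hcof, ⟨β, hβ, hqβ⟩, α, hα, hqα⟩ =>
      ⟨hlt, hmem, hcof, ⟨β, hβ, hpq.trans hqβ⟩, α, hα, hpq.trans hqα⟩) fun p hp => by
    have hlt := hlim.succ_lt (max_lt hp hδ₀K)
    obtain ⟨α, hαA, hα⟩ := hA.2 _ hlt
    obtain ⟨β, hβB, hβ⟩ := hB.2 _ hlt
    have hα := (Order.lt_succ _).trans_le hα
    have hβ := (Order.lt_succ _).trans_le hβ
    have hδα := (le_max_right _ _).trans_lt hα
    have hδβ := (le_max_right _ _).trans_lt hβ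
    obtain ⟨σ₁, σ₂, η, ε, hη, hε, hεD, hεcof, wb, wa⟩ :=
      hpair α (hA.1 hαA) hδα β (hB.1 hβB) hδβ
    exact ⟨(σ₁, σ₂, ⟨η, hη.trans hε⟩, ⟨ε, hε⟩), hη, hεD, hεcof,
      ⟨β, wb.mem_gwalkSlice hβB (hε.trans hδβ), ((le_max_left _ _).trans_lt hβ).le⟩,
      α, wa.mem_gwalkSlice hαA (hε.trans hδα), ((le_max_left _ _).trans_lt hα).le⟩
  obtain ⟨hη, hεD, hεcof, -⟩ := ht 0 hlim.bot_lt
  refine ⟨ε, ⟨hD.1 hεD, hεcof, σ₁, σ₂, η, hη, ?_, ?_⟩, hεD⟩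
  · exact mk_eq_of_unbounded hreg (fun x hx => hB.1 hx.1) fun p hp => (ht p hp).2.2.2.1
  · exact mk_eq_of_unbounded hreg (fun x hx => hA.1 hx.1) fun p hp => (ht p hp).2.2.2.2
end
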